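/- The distribution of the coefficients of DExc_n^±(t) is asymptotically normal as n → ∞. Moreover, for n ≥ 3 the mean of the coefficient distribution of DExc_n^±(t) equals n/2, and for n ≥ 4 its variance equals (n+1)/12. -/

import Mathlib

open scoped BigOperators

/-- A model of the hyperoctahedral group `B_n`: a signed permutation is a permutation of
`{1,...,n}` together with a sign for each position; `π_i = ±σ(i)`. -/
abbrev BG (n : ℕ) := Equiv.Perm (Fin n) × (Fin n → Bool)

/-- The value `π_{i+1} ∈ {−n,...,−1,1,...,n}` of a signed permutation at (0-indexed) position `i`. -/
def bval {n : ℕ} (π : BG n) (i : Fin n) : ℤ :=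
  (if π.2 i then -1 else 1) * ((π.1 i : ℤ) + 1)

/-- The value `π_i` at 1-indexed position `i ∈ {1,...,n}`, with the convention `π_0 = 0`. -/
def bvalExt {n : ℕ} (π : BG n) (i : ℕ) : ℤ :=
  if h : 1 ≤ i ∧ i ≤ n then bval π ⟨i - 1, by omega⟩ else 0

/-- `des_B(π) = |{i ∈ {0,...,n−1} : π_i > π_{i+1}}|` with `π_0 = 0`. -/
def desB {n : ℕ} (π : BG n) : ℕ :=
  ((Finset.range n).filter (fun i => bvalExt π (i + 1) < bvalExt π i)).card

/-- `asc_B(π) = n − des_B(π)`. -/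
def ascB {n : ℕ} (π : BG n) : ℕ := n - desB π

/-- `negs(π) = |{i ∈ [n] : π_i < 0}|`. -/
def negs {n : ℕ} (π : BG n) : ℕ :=
  (Finset.univ.filter (fun i : Fin n => bval π i < 0)).card

/-- `inv_A(π) = |{1 ≤ i < j ≤ n : π_i > π_j}|` (usual order on `ℤ`). -/
def invAB {n : ℕ} (π : BG n) : ℕ :=
  (Finset.univ.filter (fun p : Fin n × Fin n => p.1 < p.2 ∧ bval π p.2 < bval π p.1)).card

/-- `inv_D(π) = inv_A(π) + |{1 ≤ i < j ≤ n : −π_i > π_j}|`. -/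
def invDB {n : ℕ} (π : BG n) : ℕ :=
  invAB π +
    (Finset.univ.filter (fun p : Fin n × Fin n => p.1 < p.2 ∧ bval π p.2 < -bval π p.1)).card

/-- `inv_B(π) = inv_A(π) + |{1 ≤ i < j ≤ n : −π_i > π_j}| + negs(π)`. -/
def invBB {n : ℕ} (π : BG n) : ℕ := invDB π + negs π

/-- `exc_B(π) = |{i ∈ [n] : π_{|π_i|} > π_i}| + |{i ∈ [n] : π_i = −i}|`. -/
def excB {n : ℕ} (π : BG n) : ℕ :=
  (Finset.univ.filter (fun i : Fin n => bval π i < bvalExt π (bval π i).natAbs)).card +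
    (Finset.univ.filter (fun i : Fin n => bval π i = -((i : ℤ) + 1))).card

/-- The cumulative distribution function of the standard normal distribution. -/
noncomputable def stdNormalCDF (x : ℝ) : ℝ :=
  ∫ t in Set.Iic x, Real.exp (-t ^ 2 / 2) / Real.sqrt (2 * Real.pi)

/-- Row sum `Sum_n = Σ_k s_{n,k}` of a triangular array of counts. -/
noncomputable def rowSum (c : ℕ → ℕ → ℕ) (n : ℕ) : ℝ := ∑' k : ℕ, (c n k : ℝ)

/-- Mean `Σ_k k·s_{n,k}/Sum_n` of row `n`. -/
noncomputable def rowMean (c : ℕ → ℕ → ℕ) (n : ℕ) : ℝ :=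
  (∑' k : ℕ, (k : ℝ) * (c n k : ℝ)) / rowSum c n

/-- Variance `Σ_k k²·s_{n,k}/Sum_n − (mean)²` of row `n`. -/
noncomputable def rowVar (c : ℕ → ℕ → ℕ) (n : ℕ) : ℝ :=
  (∑' k : ℕ, (k : ℝ) ^ 2 * (c n k : ℝ)) / rowSum c n - rowMean c n ^ 2

/-- `Σ_{k ≤ ⌊y⌋} s_{n,k} / Sum_n` (for `k : ℕ`, `k ≤ ⌊y⌋ ↔ (k:ℝ) ≤ y`). -/
noncomputable def rowCDF (c : ℕ → ℕ → ℕ) (n : ℕ) (y : ℝ) : ℝ :=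
  (∑' k : ℕ, if (k : ℝ) ≤ y then (c n k : ℝ) else 0) / rowSum c n

/-- The triangular array `c` is asymptotically normal:
`lim_n sup_x |Σ_{k ≤ ⌊xσ_n + μ_n⌋} s_{n,k}/Sum_n − Φ(x)| = 0`, where `μ_n`, `σ_n²` are
the mean and variance of row `n`. -/
def IsAsympNormal (c : ℕ → ℕ → ℕ) : Prop :=
  Filter.Tendsto
    (fun n => ⨆ x : ℝ,
      |rowCDF c n (x * Real.sqrt (rowVar c n) + rowMean c n) - stdNormalCDF x|)
    Filter.atTop (nhds 0)

/-- Number of `π ∈ D_n^+` with `exc_D(π) = k` (where `exc_D = exc_B` on `D_n`). -/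
def cDExcP (n k : ℕ) : ℕ :=
  (Finset.univ.filter
    (fun π : BG n => Even (negs π) ∧ Even (invDB π) ∧ excB π = k)).card

/-- Number of `π ∈ D_n^-` with `exc_D(π) = k`. -/
def cDExcM (n k : ℕ) : ℕ :=
  (Finset.univ.filter
    (fun π : BG n => Even (negs π) ∧ ¬ Even (invDB π) ∧ excB π = k)).card

open Finset Polynomial

section Combinatorics

variable {n : ℕ}

/-- The number of cyclic valleys of a permutation. -/
def valleys (σ : Equiv.Perm (Fin n)) : ℕ := ∑ i, if ¬ i < σ i ∧ σ i < σ (σ i) then 1 else 0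

theorem valleys_decomposeFin_zero (e : Equiv.Perm (Fin n)) :
    valleys (Equiv.Perm.decomposeFin.symm (0, e)) = valleys e := by
  unfold valleys
  rw [Fin.sum_univ_succ]
  simp only [Equiv.Perm.decomposeFin_symm_apply_zero, Equiv.Perm.decomposeFin_symm_apply_succ,
    Equiv.swap_self, Equiv.refl_apply, Fin.succ_lt_succ_iff, lt_irrefl, and_false, if_false,
    zero_add]

theorem valleys_decomposeFin_succ (e : Equiv.Perm (Fin n)) (h : Fin n) :
    valleys (Equiv.Perm.decomposeFin.symm ((e (e h)).succ, e)) +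
      ((if ¬ e h < e (e h) ∧ e (e h) < e (e (e h)) then 1 else 0) +
        (if ¬ h < e h ∧ e h < e (e h) then 1 else 0)) = valleys e + 1 := by
  have key : ∀ x : Fin n, Equiv.Perm.decomposeFin.symm ((e (e h)).succ, e) x.succ =
      if x = e h then 0 else (e x).succ := by
    intro x
    rw [Equiv.Perm.decomposeFin_symm_apply_succ]
    by_cases hx : x = e h
    · simp [hx]
    · rw [if_neg hx, Equiv.swap_apply_of_ne_of_ne (Fin.succ_ne_zero _)]
      simpa using hx
  unfold valleys
  rw [Fin.sum_univ_succ]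
  simp only [Equiv.Perm.decomposeFin_symm_apply_zero, key, Fin.succ_pos, not_true, false_and,
    if_false, zero_add]
  have e1 : (if ¬ e h < e (e h) ∧ e (e h) < e (e (e h)) then 1 else 0) =
      ∑ x, if x = e h then (if ¬ e h < e (e h) ∧ e (e h) < e (e (e h)) then 1 else 0) else 0 := by
    simp
  have e2 : (if ¬ h < e h ∧ e h < e (e h) then 1 else 0) =
      ∑ x, if x = h then (if ¬ h < e h ∧ e h < e (e h) then 1 else 0) else 0 := by
    simp
  have e3 : 1 = ∑ x, if x = e h then 1 else 0 := by simp
  rw [e1, e2]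
  conv_rhs => rw [e3]
  rw [← sum_add_distrib, ← sum_add_distrib, ← sum_add_distrib]
  refine sum_congr rfl fun x _ => ?_
  by_cases h1 : x = e h
  · subst h1
    by_cases h2 : e h = h
    · simp [h2]
    · simp [h2]
      omega
  · by_cases h2 : x = h
    · subst h2
      simp [h1]
    · have h3 : e x ≠ e h := fun h' => h2 (e.injective h')
      simp [h1, h2, key, h3]

theorem sum_valley_indicators (e : Equiv.Perm (Fin n)) :
    ∑ h, ((if ¬ e h < e (e h) ∧ e (e h) < e (e (e h)) then 1 else 0) +
        (if ¬ h < e h ∧ e h < e (e h) then 1 else 0)) = 2 * valleys e := by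
  rw [sum_add_distrib, Equiv.sum_comp e (fun h => if ¬ h < e h ∧ e h < e (e h) then 1 else 0),
    valleys, two_mul]

theorem two_mul_valleys_le (e : Equiv.Perm (Fin n)) : 2 * valleys e ≤ n := by
  rw [← sum_valley_indicators]
  calc _ ≤ ∑ _h : Fin n, 1 := by
        refine sum_le_sum fun h _ => ?_
        split_ifs <;> omega
    _ = n := by simp

/-- The excedance enumerator of the `2 ^ n` signed permutations lying over a fixed permutation
with `v` cyclic valleys. -/
noncomputable def valleyWeight (n v : ℕ) : ℝ[X] := (1 + X) ^ (n - 2 * v) * (4 * X) ^ v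

theorem valleyWeight_succ {v : ℕ} (hv : 2 * v ≤ n) :
    2 * (v : ℝ[X]) * valleyWeight (n + 1) v +
        ((n : ℝ[X]) - 2 * (v : ℝ[X])) * valleyWeight (n + 1) (v + 1) =
      2 * (n : ℝ[X]) * X * valleyWeight n v + 2 * X * (1 - X) * derivative (valleyWeight n v) := by
  obtain ⟨a, rfl⟩ := Nat.exists_eq_add_of_le hv
  unfold valleyWeight
  have h1 : 2 * v + a + 1 - 2 * v = a + 1 := by omega
  have h2 : 2 * v + a - 2 * v = a := by omega
  have h3 : 2 * v + a + 1 - 2 * (v + 1) = a - 1 := by omega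
  rw [h1, h2, h3]
  have h4 : derivative (1 + X : ℝ[X]) = 1 := by simp
  have h5 : derivative (4 * X : ℝ[X]) = 4 := by
    rw [show (4 : ℝ[X]) = C 4 from rfl]; simp
  rw [derivative_mul, derivative_pow, derivative_pow, h4, h5]
  rcases a with _ | a <;> rcases v with _ | v <;>
    · simp [pow_succ]
      try ring

theorem valleyWeight_succ_self {v : ℕ} (hv : 2 * v ≤ n) :
    valleyWeight (n + 1) v = (1 + X) * valleyWeight n v := by
  unfold valleyWeight
  rw [show n + 1 - 2 * v = (n - 2 * v) + 1 by omega]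
  ring

/-- The enumerator of permutations by cyclic valleys, twisted by a character `s` of the sign. -/
noncomputable def valleyPoly (s : ℤˣ → ℝ[X]) (n : ℕ) : ℝ[X] :=
  ∑ σ : Equiv.Perm (Fin n), s (Equiv.Perm.sign σ) * valleyWeight n (valleys σ)

theorem sum_valleyWeight_decomposeFin (e : Equiv.Perm (Fin n)) :
    ∑ j : Fin n, valleyWeight (n + 1) (valleys (Equiv.Perm.decomposeFin.symm (j.succ, e))) =
      2 * (n : ℝ[X]) * X * valleyWeight n (valleys e) +
        2 * X * (1 - X) * derivative (valleyWeight n (valleys e)) := by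
  rw [← valleyWeight_succ (two_mul_valleys_le e)]
  rw [← Equiv.sum_comp e, ← Equiv.sum_comp e]
  set f : Fin n → ℕ := fun h => ((if ¬ e h < e (e h) ∧ e (e h) < e (e (e h)) then 1 else 0) +
        (if ¬ h < e h ∧ e h < e (e h) then 1 else 0)) with hf
  have hs : ∑ h, f h = 2 * valleys e := sum_valley_indicators e
  have hterm : ∀ h, valleyWeight (n + 1)
      (valleys (Equiv.Perm.decomposeFin.symm ((e (e h)).succ, e))) =
      f h * valleyWeight (n + 1) (valleys e) + (1 - f h) * valleyWeight (n + 1) (valleys e + 1) := by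
    intro h
    have h1 := valleys_decomposeFin_succ e h
    change _ + f h = _ at h1
    have h2 : f h = 0 ∨ f h = 1 := by
      simp only [hf]
      split_ifs <;> omega
    rcases h2 with h2 | h2 <;> rw [h2] at h1 ⊢
    · simp at h1
      simp [h1]
    · simp at h1
      simp [h1]
  rw [sum_congr rfl fun h _ => hterm h, sum_add_distrib, ← sum_mul, ← sum_mul, sum_sub_distrib,
    ← Nat.cast_sum, hs]
  simp

theorem valleyPoly_succ (s : ℤˣ →* ℝ[X]) :
    valleyPoly s (n + 1) = (1 + X) * valleyPoly s n +
      s (-1) * (2 * (n : ℝ[X]) * X * valleyPoly s n +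
        2 * X * (1 - X) * derivative (valleyPoly s n)) := by
  have hs : ∀ u : ℤˣ, derivative (s u) = 0 := by
    intro u
    rcases Int.units_eq_one_or u with rfl | rfl
    · simp
    · have : s (-1) * s (-1) = 1 := by rw [← map_mul]; simp
      rcases mul_self_eq_one_iff.mp this with h | h <;> simp [h]
  unfold valleyPoly
  rw [← Equiv.sum_comp Equiv.Perm.decomposeFin.symm, Fintype.sum_prod_type, sum_comm]
  rw [derivative_sum]
  simp only [mul_sum]
  rw [← sum_add_distrib, mul_sum, ← sum_add_distrib]
  refine sum_congr rfl fun e _ => ?_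
  rw [Fin.sum_univ_succ]
  simp only [Equiv.Perm.decomposeFin.symm_sign, valleys_decomposeFin_zero, if_true, one_mul,
    Fin.succ_ne_zero, if_false, map_mul, ← mul_sum, derivative_mul, hs]
  rw [sum_valleyWeight_decomposeFin, valleyWeight_succ_self (two_mul_valleys_le e)]
  ring

theorem valleyPoly_zero (s : ℤˣ →* ℝ[X]) : valleyPoly s 0 = 1 := by
  simp [valleyPoly, valleyWeight, valleys]

theorem bval_neg_iff (π : BG n) (i : Fin n) : bval π i < 0 ↔ π.2 i = true := by
  unfold bval
  cases π.2 i <;> simp <;> omega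

theorem bvalExt_natAbs_bval (π : BG n) (i : Fin n) :
    bvalExt π (bval π i).natAbs = bval π (π.1 i) := by
  have h : (bval π i).natAbs = (π.1 i : ℕ) + 1 := by
    unfold bval
    cases π.2 i <;> simp <;> omega
  unfold bvalExt
  rw [h, dif_pos ⟨by omega, by omega⟩]
  rfl

theorem excB_eq (π : BG n) :
    excB π = ∑ i, ((if ¬ π.2 i = true ∧ i < π.1 i then 1 else 0) +
      (if π.2 i = true ∧ ¬ π.1 i < π.1 (π.1 i) then 1 else 0)) := by
  rw [sum_add_distrib, ← Equiv.sum_comp π.1]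
  unfold excB
  rw [card_filter, card_filter, ← sum_add_distrib, ← sum_add_distrib]
  refine sum_congr rfl fun i _ => ?_
  rw [bvalExt_natAbs_bval]
  have hfix : (π.1 (π.1 i) : ℕ) = π.1 i ↔ (π.1 i : ℕ) = i := by
    simp [← Fin.ext_iff]
  have hsign : (π.1 i : ℕ) = i → π.2 (π.1 i) = π.2 i := fun h => by rw [Fin.ext h]
  unfold bval
  simp only [Fin.lt_def]
  rcases hi : π.2 i <;> rcases hj : π.2 (π.1 i) <;>
    simp only [Bool.false_eq_true, not_false_eq_true, not_true_eq_false, true_and, false_and,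
      if_true, if_false] <;> split_ifs <;>
    first
    | omega
    | exact absurd (hsign (by omega)) (by simp [hi, hj])

theorem neg_one_pow_negs (π : BG n) :
    (-1 : ℝ[X]) ^ negs π = ∏ i, if π.2 i = true then -1 else 1 := by
  unfold negs
  simp only [bval_neg_iff]
  rw [prod_ite]
  simp

theorem sum_signs (q : ℝ[X]) (σ : Equiv.Perm (Fin n)) :
    ∑ ε : Fin n → Bool, (∏ i, if ε i = true then q else 1) * X ^ excB (σ, ε) =
      ∏ i, ((if i < σ i then X else 1) + q * (if σ i < σ (σ i) then 1 else X)) := by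
  have h : ∀ i, ((if i < σ i then X else 1) + q * (if σ i < σ (σ i) then 1 else X)) =
      ∑ b : Bool, if b = true then q * (if σ i < σ (σ i) then 1 else X)
        else (if i < σ i then X else 1) := by
    intro i
    simp [add_comm]
  rw [prod_congr rfl fun i _ => h i, prod_univ_sum, Fintype.piFinset_univ]
  refine sum_congr rfl fun ε _ => ?_
  rw [excB_eq, ← prod_pow_eq_pow_sum, ← prod_mul_distrib]
  refine prod_congr rfl fun i _ => ?_
  by_cases h1 : i < σ i <;> by_cases h2 : σ i < σ (σ i) <;> rcases hi : ε i <;>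
    simp [hi, h1, h2, -not_lt]

theorem sum_signs_one (σ : Equiv.Perm (Fin n)) :
    ∏ i, (((if i < σ i then X else 1) + 1 * (if σ i < σ (σ i) then 1 else X)) : ℝ[X]) =
      valleyWeight n (valleys σ) := by
  have h : ∀ i, (((if i < σ i then X else 1) + 1 * (if σ i < σ (σ i) then 1 else X)) : ℝ[X]) =
      (if ¬ i < σ i ∧ σ i < σ (σ i) then 2 else 1) *
        (if i < σ i ∧ ¬ σ i < σ (σ i) then 2 * X else 1) *
        (if (i < σ i ↔ σ i < σ (σ i)) then 1 + X else 1) := by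
    intro i
    by_cases h1 : i < σ i <;> by_cases h2 : σ i < σ (σ i) <;> simp [h1, h2] <;> ring
  have hv : #{i | ¬ i < σ i ∧ σ i < σ (σ i)} = valleys σ := by
    rw [card_filter, valleys]
  have hp : #{i | i < σ i ∧ ¬ σ i < σ (σ i)} = valleys σ := by
    have : ∑ i, (if i < σ i then 1 else 0) = ∑ i, (if σ i < σ (σ i) then 1 else 0) :=
      (Equiv.sum_comp σ fun i => if i < σ i then 1 else 0).symm
    have h2 : ∑ i, (if i < σ i ∧ ¬ σ i < σ (σ i) then 1 else 0) +
        ∑ i, (if σ i < σ (σ i) then 1 else 0) =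
        ∑ i, (if ¬ i < σ i ∧ σ i < σ (σ i) then 1 else 0) + ∑ i, (if i < σ i then 1 else 0) := by
      rw [← sum_add_distrib, ← sum_add_distrib]
      refine sum_congr rfl fun i _ => ?_
      split_ifs <;> omega
    rw [card_filter, valleys]
    omega
  have hc : #{i | i < σ i ↔ σ i < σ (σ i)} = n - 2 * valleys σ := by
    have : ∑ i, (if ¬ i < σ i ∧ σ i < σ (σ i) then 1 else 0) +
        ∑ i, (if i < σ i ∧ ¬ σ i < σ (σ i) then 1 else 0) +
        ∑ i, (if (i < σ i ↔ σ i < σ (σ i)) then 1 else 0) = ∑ _i : Fin n, 1 := by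
      rw [← sum_add_distrib, ← sum_add_distrib]
      refine sum_congr rfl fun i _ => ?_
      split_ifs <;> omega
    rw [← card_filter, ← card_filter, ← card_filter, hv, hp] at this
    simp at this
    omega
  rw [prod_congr rfl fun i _ => h i, prod_mul_distrib, prod_mul_distrib, prod_ite, prod_ite,
    prod_ite]
  simp only [prod_const, one_pow, mul_one]
  rw [hv, hp, hc, valleyWeight, ← mul_pow]
  ring

theorem sum_signs_neg_one (σ : Equiv.Perm (Fin n)) :
    ∏ i, (((if i < σ i then X else 1) + (-1) * (if σ i < σ (σ i) then 1 else X)) : ℝ[X]) =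
      if σ = 1 then (1 - X) ^ n else 0 := by
  split_ifs with hσ
  · subst hσ
    simp [sub_eq_add_neg]
  · by_contra hne
    have h1 : ∀ i, i < σ i ↔ σ i < σ (σ i) := by
      intro i
      have := (prod_ne_zero_iff.mp hne) i (mem_univ i)
      by_contra hi
      apply this
      by_cases h1 : i < σ i <;> by_cases h2 : σ i < σ (σ i) <;> simp [h1, h2] at hi ⊢
    have h2 : ∀ k i, i < σ i → (i : ℕ) + k ≤ ((σ ^ k) i : ℕ) ∧ (σ ^ k) i < σ ((σ ^ k) i) := by
      intro k
      induction k with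
      | zero => intro i hi; simpa using hi
      | succ k ih =>
        intro i hi
        obtain ⟨h3, h4⟩ := ih i hi
        rw [pow_succ', Equiv.Perm.mul_apply]
        refine ⟨?_, (h1 _).mp h4⟩
        rw [Fin.lt_def] at h4
        omega
    have h3 : ∀ i, σ i ≤ i := by
      intro i
      by_contra hi
      have := (h2 n i (not_le.mp hi)).1
      omega
    apply hσ
    ext i
    have h4 : ∀ m, ∀ i : Fin n, (i : ℕ) = m → σ i = i := by
      intro m
      induction m using Nat.strong_induction_on with
      | _ m ih =>
        intro i hi
        rcases (h3 i).lt_or_eq with h | h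
        · exact σ.injective (ih _ (by rw [Fin.lt_def] at h; omega) (σ i) rfl)
        · exact h
    simp [h4 _ i rfl]

theorem neg_one_pow_invDB (π : BG n) : (-1 : ℤˣ) ^ invDB π = Equiv.Perm.sign π.1 := by
  rw [Equiv.Perm.sign_eq_prod_prod_Ioi]
  unfold invDB invAB
  rw [card_filter, card_filter, ← sum_add_distrib, ← prod_pow_eq_pow_sum, Fintype.prod_prod_type]
  refine prod_congr rfl fun i _ => ?_
  rw [← Finset.filter_lt_eq_Ioi, prod_filter]
  refine prod_congr rfl fun j _ => ?_
  by_cases hij : i < j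
  · have hne : (π.1 i : ℕ) ≠ π.1 j := by
      simp [← Fin.ext_iff, hij.ne]
    unfold bval
    simp only [hij, true_and, if_true, Fin.lt_def]
    rcases π.2 i <;> rcases π.2 j <;> rcases lt_or_gt_of_ne hne with h | h <;>
      simp only [Bool.false_eq_true, if_true, if_false, h, h.not_gt] <;>
      split_ifs <;> first | omega | simp
  · simp [hij]

/-- The inclusion of the integer units into polynomials. -/
noncomputable def unitHom : ℤˣ →* ℝ[X] :=
  (Int.castRingHom ℝ[X] : ℤ →* ℝ[X]).comp (Units.coeHom ℤ)

theorem sum_negs_excB (s : ℤˣ →* ℝ[X]) :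
    ∑ π : BG n, (1 + (-1) ^ negs π) * s (Equiv.Perm.sign π.1) * X ^ excB π =
      valleyPoly s n + (1 - X) ^ n := by
  rw [Fintype.sum_prod_type]
  have h : ∀ σ : Equiv.Perm (Fin n), ∑ ε : Fin n → Bool,
      (1 + (-1) ^ negs (σ, ε)) * s (Equiv.Perm.sign σ) * X ^ excB (σ, ε) =
      s (Equiv.Perm.sign σ) * valleyWeight n (valleys σ) +
        s (Equiv.Perm.sign σ) * if σ = 1 then (1 - X) ^ n else 0 := by
    intro σ
    rw [← sum_signs_one, ← sum_signs_neg_one, ← sum_signs, ← sum_signs, mul_sum, mul_sum,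
      ← sum_add_distrib]
    refine sum_congr rfl fun ε _ => ?_
    rw [neg_one_pow_negs]
    simp
    ring
  simp only [h, sum_add_distrib]
  simp [valleyPoly]

theorem four_mul_cDExcP (n k : ℕ) :
    4 * (cDExcP n k : ℝ) =
      (valleyPoly (1 : ℤˣ →* ℝ[X]) n + (valleyPoly unitHom n + 2 * (1 - X) ^ n)).coeff k := by
  have h : valleyPoly (1 : ℤˣ →* ℝ[X]) n + (valleyPoly unitHom n + 2 * (1 - X) ^ n) =
      (valleyPoly (1 : ℤˣ →* ℝ[X]) n + (1 - X) ^ n) +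
        (valleyPoly unitHom n + (1 - X) ^ n) := by ring
  rw [h, ← sum_negs_excB, ← sum_negs_excB, ← sum_add_distrib, finsetSum_coeff, cDExcP,
    card_filter, Nat.cast_sum, mul_sum]
  refine sum_congr rfl fun π _ => ?_
  rw [← neg_one_pow_invDB]
  rcases Nat.even_or_odd (negs π) with h1 | h1 <;> rcases Nat.even_or_odd (invDB π) with h2 | h2
  · have : ((1 + 1) * 1 * X ^ excB π + (1 + 1) * 1 * X ^ excB π : ℝ[X]) = C 4 * X ^ excB π := by
      rw [show (C 4 : ℝ[X]) = 4 from rfl]; ring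
    simp only [h1.neg_one_pow, h2.neg_one_pow, map_one, this, h1, h2, coeff_C_mul, coeff_X_pow]
    simp [eq_comm]
  · have : ((1 + 1) * 1 * X ^ excB π + (1 + 1) * -1 * X ^ excB π : ℝ[X]) = 0 := by ring
    have h3 : unitHom (-1) = -1 := by simp [unitHom]
    rw [h1.neg_one_pow, h2.neg_one_pow, h3, MonoidHom.one_apply, this]
    simp [Nat.not_even_iff_odd.mpr h2]
  · simp [h1.neg_one_pow, Nat.not_even_iff_odd.mpr h1]
  · simp [h1.neg_one_pow, Nat.not_even_iff_odd.mpr h1]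

theorem four_mul_cDExcM (n k : ℕ) :
    4 * (cDExcM n k : ℝ) =
      (valleyPoly (1 : ℤˣ →* ℝ[X]) n + -valleyPoly unitHom n).coeff k := by
  have h : valleyPoly (1 : ℤˣ →* ℝ[X]) n + -valleyPoly unitHom n =
      (valleyPoly (1 : ℤˣ →* ℝ[X]) n + (1 - X) ^ n) -
        (valleyPoly unitHom n + (1 - X) ^ n) := by ring
  rw [h, ← sum_negs_excB, ← sum_negs_excB, ← sum_sub_distrib, finsetSum_coeff, cDExcM,
    card_filter, Nat.cast_sum, mul_sum]
  refine sum_congr rfl fun π _ => ?_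
  rw [← neg_one_pow_invDB]
  rcases Nat.even_or_odd (negs π) with h1 | h1 <;> rcases Nat.even_or_odd (invDB π) with h2 | h2
  · simp [h1.neg_one_pow, h2.neg_one_pow, h2]
  · have : ((1 + 1) * 1 * X ^ excB π - (1 + 1) * -1 * X ^ excB π : ℝ[X]) = C 4 * X ^ excB π := by
      rw [show (C 4 : ℝ[X]) = 4 from rfl]; ring
    have h3 : unitHom (-1) = -1 := by simp [unitHom]
    simp only [h1.neg_one_pow, h2.neg_one_pow, MonoidHom.one_apply, h3, this, h1,
      Nat.not_even_iff_odd.mpr h2, coeff_C_mul, coeff_X_pow]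
    simp [eq_comm]
  · simp [h1.neg_one_pow, Nat.not_even_iff_odd.mpr h1]
  · simp [h1.neg_one_pow, Nat.not_even_iff_odd.mpr h1]

theorem valleyPoly_one_succ (n : ℕ) :
    valleyPoly (1 : ℤˣ →* ℝ[X]) (n + 1) =
      (1 + (2 * (n : ℝ[X]) + 1) * X) * valleyPoly (1 : ℤˣ →* ℝ[X]) n +
        2 * X * (1 - X) * derivative (valleyPoly (1 : ℤˣ →* ℝ[X]) n) := by
  rw [valleyPoly_succ]
  simp
  ring

theorem valleyPoly_unitHom (m : ℕ) :
    valleyPoly unitHom (2 * m) = (1 - X) ^ (2 * m) ∧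
      valleyPoly unitHom (2 * m + 1) = (1 - X) ^ (2 * m) * (1 + X) := by
  have h3 : unitHom (-1) = -1 := by simp [unitHom]
  have odd_of_even : ∀ m, valleyPoly unitHom (2 * m) = (1 - X) ^ (2 * m) →
      valleyPoly unitHom (2 * m + 1) = (1 - X) ^ (2 * m) * (1 + X) := by
    intro m h
    rw [valleyPoly_succ, h, h3, derivative_pow]
    rcases m with _ | m
    · simp
    · rw [show 2 * (m + 1) - 1 = 2 * m + 1 by omega, show 2 * (m + 1) = 2 * m + 1 + 1 by omega]
      simp [show (C 2 : ℝ[X]) = 2 from rfl]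
      ring
  suffices h : valleyPoly unitHom (2 * m) = (1 - X) ^ (2 * m) from ⟨h, odd_of_even m h⟩
  induction m with
  | zero => simp [valleyPoly_zero]
  | succ m ih =>
    rw [show 2 * (m + 1) = 2 * m + 1 + 1 by ring, valleyPoly_succ, odd_of_even m ih, h3,
      derivative_mul, derivative_pow]
    rcases m with _ | m
    · simp
      ring
    · rw [show 2 * (m + 1) - 1 = 2 * m + 1 by omega, show 2 * (m + 1) = 2 * m + 1 + 1 by omega]
      simp [show (C 2 : ℝ[X]) = 2 from rfl]
      ring

end Combinatorics

section IrwinHall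

open MeasureTheory

/-- Iterated backward differences with unit step. -/
def bdiff : ℕ → (ℝ → ℝ) → ℝ → ℝ
  | 0, f, x => f x
  | m + 1, f, x => bdiff m f x - bdiff m f (x - 1)

theorem bdiff_id_mul (f : ℝ → ℝ) (m : ℕ) (x : ℝ) :
    bdiff (m + 1) (fun y => y * f y) x =
      x * bdiff (m + 1) f x + (m + 1) * bdiff m f (x - 1) := by
  induction m generalizing x with
  | zero => simp [bdiff]; ring
  | succ m ih =>
    rw [bdiff, ih, ih]
    have h₁ : ∀ y, bdiff (m + 1 + 1) f y = bdiff (m + 1) f y - bdiff (m + 1) f (y - 1) :=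
      fun _ => rfl
    have h₂ : bdiff (m + 1) f (x - 1) = bdiff m f (x - 1) - bdiff m f (x - 1 - 1) := rfl
    rw [h₁, h₂]
    push_cast
    ring

theorem bdiff_sub_shift (g : ℝ → ℝ) (m : ℕ) (x : ℝ) :
    bdiff m (fun y => g y - g (y - 1)) x = bdiff (m + 1) g x := by
  induction m generalizing x with
  | zero => simp [bdiff]
  | succ m ih =>
    rw [bdiff, ih, ih]
    rfl

theorem bdiff_eq_zero {f : ℝ → ℝ} (hf : ∀ x < 0, f x = 0) (m : ℕ) {x : ℝ} (hx : x < 0) :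
    bdiff m f x = 0 := by
  induction m generalizing x with
  | zero => exact hf x hx
  | succ m ih => rw [bdiff, ih hx, ih (by linarith), sub_zero]

theorem bdiff_const_mul (c : ℝ) (f : ℝ → ℝ) (m : ℕ) (x : ℝ) :
    bdiff m (fun y => c * f y) x = c * bdiff m f x := by
  induction m generalizing x with
  | zero => simp [bdiff]
  | succ m ih => rw [bdiff, ih, ih, bdiff]; ring

theorem intervalIntegrable_bdiff {f : ℝ → ℝ}
    (hf : ∀ x, IntervalIntegrable (fun u => f (x - u)) volume 0 1) (m : ℕ) (x : ℝ) :
    IntervalIntegrable (fun u => bdiff m f (x - u)) volume 0 1 := by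
  induction m generalizing x with
  | zero => exact hf x
  | succ m ih =>
    simp only [bdiff]
    refine (ih x).sub ?_
    convert ih (x - 1) using 3
    ring

theorem integral_bdiff {f : ℝ → ℝ}
    (hf : ∀ x, IntervalIntegrable (fun u => f (x - u)) volume 0 1) (m : ℕ) (x : ℝ) :
    ∫ u in (0 : ℝ)..1, bdiff m f (x - u) = bdiff m (fun y => ∫ u in (0 : ℝ)..1, f (y - u)) x := by
  induction m generalizing x with
  | zero => rfl
  | succ m ih =>
    simp only [bdiff]
    have h : ∀ u, x - u - 1 = (x - 1) - u := fun u => by ring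
    simp only [h]
    rw [intervalIntegral.integral_sub (intervalIntegrable_bdiff hf m x)
      (intervalIntegrable_bdiff hf m (x - 1)), ih, ih]

/-- The normalized truncated power `x₊ⁿ / n!`. -/
noncomputable def truncPow (n : ℕ) (x : ℝ) : ℝ := if 0 ≤ x then x ^ n / n.factorial else 0

theorem truncPow_of_neg (n : ℕ) : ∀ x < 0, truncPow n x = 0 := fun _ hx => if_neg hx.not_ge

theorem id_mul_truncPow (n : ℕ) (x : ℝ) :
    x * truncPow n x = (n + 1) * truncPow (n + 1) x := by
  unfold truncPow
  split_ifs
  · rw [Nat.factorial_succ]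
    push_cast
    field_simp
    ring
  · simp

theorem monotone_truncPow (n : ℕ) : Monotone (truncPow n) := by
  intro x y h
  unfold truncPow
  split_ifs with h1 h2
  · gcongr
  · linarith
  · positivity
  · rfl

theorem continuous_truncPow_succ (n : ℕ) : Continuous (truncPow (n + 1)) := by
  have : truncPow (n + 1) = fun x => (max x 0) ^ (n + 1) / ((n + 1).factorial : ℝ) := by
    ext x
    unfold truncPow
    split_ifs with h
    · rw [max_eq_left h]
    · rw [max_eq_right (not_le.mp h).le]; simp
  rw [this]
  fun_prop

theorem hasDerivWithinAt_truncPow (n : ℕ) (x : ℝ) :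
    HasDerivWithinAt (truncPow (n + 1)) (truncPow n x) (Set.Ioi x) x := by
  rcases lt_or_ge x 0 with hx | hx
  · rw [truncPow_of_neg n x hx]
    refine (HasDerivAt.congr_of_eventuallyEq (hasDerivAt_const x (0 : ℝ)) ?_).hasDerivWithinAt
    filter_upwards [gt_mem_nhds hx] with y hy using truncPow_of_neg _ y hy
  · have h : HasDerivAt (fun y : ℝ => y ^ (n + 1) / ((n + 1).factorial : ℝ)) (truncPow n x) x := by
      refine ((hasDerivAt_pow (n + 1) x).div_const ((n + 1).factorial : ℝ)).congr_deriv ?_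
      have ht : truncPow n x = x ^ n / n.factorial := if_pos hx
      rw [ht, Nat.factorial_succ]
      push_cast
      field_simp
    refine h.hasDerivWithinAt.congr (fun y hy => ?_) ?_
    · exact if_pos (hx.trans (le_of_lt hy))
    · exact if_pos hx

theorem integral_truncPow (n : ℕ) (x : ℝ) :
    ∫ u in (0 : ℝ)..1, truncPow n (x - u) = truncPow (n + 1) x - truncPow (n + 1) (x - 1) := by
  rw [intervalIntegral.integral_comp_sub_left (fun u => truncPow n u) x, sub_zero]
  exact intervalIntegral.integral_eq_sub_of_hasDeriv_right (continuous_truncPow_succ n).continuousOn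
    (fun y _ => hasDerivWithinAt_truncPow n y) (monotone_truncPow n).intervalIntegrable

/-- The distribution function of the sum of `n` independent uniform variables on `[0, 1]`. -/
noncomputable def irwinHall (n : ℕ) (x : ℝ) : ℝ := bdiff n (truncPow n) x

theorem irwinHall_of_neg (n : ℕ) {x : ℝ} (hx : x < 0) : irwinHall n x = 0 :=
  bdiff_eq_zero (truncPow_of_neg n) n hx

theorem irwinHall_succ (n : ℕ) (x : ℝ) :
    (n + 1) * irwinHall (n + 1) x =
      x * irwinHall n x + (n + 1 - x) * irwinHall n (x - 1) := by
  unfold irwinHall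
  rw [← bdiff_const_mul]
  have h : (fun y => ((n : ℝ) + 1) * truncPow (n + 1) y) = fun y => y * truncPow n y := by
    ext y
    rw [id_mul_truncPow]
  rw [h, bdiff_id_mul, bdiff]
  ring

theorem integral_irwinHall (n : ℕ) (x : ℝ) :
    ∫ u in (0 : ℝ)..1, irwinHall n (x - u) = irwinHall (n + 1) x := by
  unfold irwinHall
  rw [integral_bdiff]
  · simp only [integral_truncPow]
    exact bdiff_sub_shift _ _ _
  · intro y
    exact Antitone.intervalIntegrable fun a b h => monotone_truncPow n (by linarith)

theorem conv_Iic (ν μ : Measure ℝ) [SFinite ν] [SFinite μ] (x : ℝ) :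
    (ν ∗ μ) (Set.Iic x) = ∫⁻ u, ν (Set.Iic (x - u)) ∂μ := by
  rw [Measure.conv_comm, ← lintegral_indicator_one measurableSet_Iic,
    Measure.lintegral_conv (measurable_one.indicator measurableSet_Iic)]
  refine lintegral_congr fun u => ?_
  rw [← lintegral_indicator_one measurableSet_Iic]
  refine lintegral_congr fun y => ?_
  simp only [Set.indicator, Set.mem_Iic, le_sub_iff_add_le, add_comm,
    Pi.one_apply]

theorem measureReal_conv_uniform_Iic (ν : Measure ℝ) [IsProbabilityMeasure ν] (x : ℝ) :
    (ν ∗ volume.restrict (Set.Ioc (0 : ℝ) 1)).real (Set.Iic x) =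
      ∫ u in (0 : ℝ)..1, ν.real (Set.Iic (x - u)) := by
  rw [Measure.real, conv_Iic, intervalIntegral.integral_of_le zero_le_one]
  refine (integral_toReal ?_ ?_).symm
  · refine Measurable.aemeasurable (Antitone.measurable fun a b h => ?_)
    exact measure_mono (Set.Iic_subset_Iic.mpr (by linarith))
  · exact Filter.Eventually.of_forall fun _ => measure_lt_top _ _

open ProbabilityTheory

instance : IsProbabilityMeasure (volume.restrict (Set.Ioc (0 : ℝ) 1)) :=
  ⟨by simp⟩

theorem measureReal_sum_uniform_Iic {Ω : Type*} [MeasurableSpace Ω] {P : Measure Ω}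
    [IsProbabilityMeasure P] {U : ℕ → Ω → ℝ} (hm : ∀ i, Measurable (U i))
    (hU : ∀ i, HasLaw (U i) (volume.restrict (Set.Ioc (0 : ℝ) 1)) P) (hi : iIndepFun U P)
    (n : ℕ) (x : ℝ) :
    (P.map (∑ k ∈ Finset.range n, U k)).real (Set.Iic x) = irwinHall n x := by
  induction n generalizing x with
  | zero =>
    rw [Finset.range_zero, Finset.sum_empty]
    have : P.map (0 : Ω → ℝ) = Measure.dirac 0 := by
      have := Measure.map_const P (0 : ℝ)
      rw [measure_univ, one_smul] at this
      exact this
    rw [this, measureReal_def, Measure.dirac_apply' _ measurableSet_Iic]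
    simp [irwinHall, bdiff, truncPow, Set.indicator]
    split_ifs <;> simp
  | succ n ih =>
    have hs : Measurable (∑ k ∈ Finset.range n, U k) := by
      fun_prop
    rw [Finset.sum_range_succ, (hi.indepFun_sum_range_succ hm n).map_add_eq_map_conv_map hs (hm n),
      (hU n).map_eq]
    have := Measure.isProbabilityMeasure_map (μ := P) hs.aemeasurable
    rw [measureReal_conv_uniform_Iic]
    simp only [ih]
    exact integral_irwinHall n x

theorem stdNormalCDF_eq (x : ℝ) : stdNormalCDF x = (gaussianReal 0 1).real (Set.Iic x) := by
  rw [measureReal_def, gaussianReal_apply_eq_integral _ one_ne_zero, ENNReal.toReal_ofReal]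
  · refine integral_congr_ae (Filter.Eventually.of_forall fun t => ?_)
    simp [gaussianPDFReal_def]
    ring
  · exact integral_nonneg fun t => gaussianPDFReal_nonneg _ _ _

theorem irwinHall_isCDF_and_tendsto :
    (∀ n, Monotone (irwinHall n) ∧ ∀ x, 0 ≤ irwinHall n x ∧ irwinHall n x ≤ 1) ∧
      ∀ z : ℝ, Filter.Tendsto (fun n : ℕ => irwinHall n (n / 2 + √(n / 12) * z))
        Filter.atTop (nhds (stdNormalCDF z)) := by
  obtain ⟨Ω, _, P, U, hm, hU, hi, hP⟩ :=
    exists_iid ℕ (volume.restrict (Set.Ioc (0 : ℝ) 1))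
  have hs : ∀ n, Measurable (∑ k ∈ Finset.range n, U k) := fun n => by
    fun_prop
  refine ⟨fun n => ?_, fun z => ?_⟩
  · have := Measure.isProbabilityMeasure_map (μ := P) (hs n).aemeasurable
    refine ⟨fun x y h => ?_, fun x => ?_⟩
    · rw [← measureReal_sum_uniform_Iic hm hU hi, ← measureReal_sum_uniform_Iic hm hU hi]
      exact measureReal_mono (Set.Iic_subset_Iic.mpr h)
    · rw [← measureReal_sum_uniform_Iic hm hU hi]
      exact ⟨measureReal_nonneg, measureReal_le_one⟩
  have hY : HasLaw (id : ℝ → ℝ) (gaussianReal 0 1) (gaussianReal 0 1) := HasLaw.id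
  have hmean : P[fun ω => √12 * (U 0 ω - 1 / 2)] = 0 := by
    have := (hU 0).integral_comp (f := fun u => √12 * (u - 1 / 2)) (by fun_prop)
    refine this.trans ?_
    rw [← intervalIntegral.integral_of_le zero_le_one, intervalIntegral.integral_const_mul,
      intervalIntegral.integral_sub (by simp) (by simp)]
    simp
  have hvar : P[(fun ω => √12 * (U 0 ω - 1 / 2)) ^ 2] = 1 := by
    have := (hU 0).integral_comp (f := fun u => (√12 * (u - 1 / 2)) ^ 2) (by fun_prop)
    refine this.trans ?_
    rw [← intervalIntegral.integral_of_le zero_le_one]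
    simp only [mul_pow]
    rw [intervalIntegral.integral_const_mul,
      intervalIntegral.integral_comp_sub_right (fun u => u ^ 2) (1 / 2), integral_pow,
      Real.sq_sqrt (by norm_num)]
    norm_num
  have hclt := (tendstoInDistribution_inv_sqrt_mul_sum (X := fun i ω => √12 * (U i ω - 1 / 2))
    hY hmean hvar (hi.comp (fun _ u => √12 * (u - 1 / 2)) (by fun_prop))
    (fun i => ⟨by fun_prop, by fun_prop, by
      have h : ∀ j, P.map (fun ω => √12 * (U j ω - 1 / 2)) =
          (volume.restrict (Set.Ioc (0 : ℝ) 1)).map fun u => √12 * (u - 1 / 2) := fun j =>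
        ((HasLaw.mk (by fun_prop) rfl : HasLaw (fun u : ℝ => √12 * (u - 1 / 2)) _
          (volume.restrict (Set.Ioc (0 : ℝ) 1))).comp (hU j)).map_eq
      rw [h, h]⟩)).tendsto
  have hnull : (gaussianReal 0 1).map id (frontier (Set.Iic z)) = 0 := by
    have := nullSingletonClass_gaussianReal (μ := 0) (v := 1) one_ne_zero
    rw [Measure.map_id, frontier_Iic]
    exact measure_singleton z
  have h := (ENNReal.tendsto_toReal (by
      rw [ProbabilityMeasure.coe_mk, Measure.map_id]
      exact measure_ne_top _ _)).comp
    (ProbabilityMeasure.tendsto_measure_of_null_frontier_of_tendsto' hclt hnull)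
  rw [stdNormalCDF_eq]
  simp only [ProbabilityMeasure.coe_mk, Measure.map_id] at h
  refine h.congr' ?_
  filter_upwards [Filter.eventually_gt_atTop 0] with n hn
  rw [← measureReal_sum_uniform_Iic hm hU hi, measureReal_def,
    Measure.map_apply (hs n) measurableSet_Iic, Function.comp_apply,
    Measure.map_apply (by fun_prop) measurableSet_Iic]
  congr 2
  ext ω
  have hn' : (0 : ℝ) < √n := Real.sqrt_pos.mpr (by exact_mod_cast hn)
  simp only [Set.mem_preimage, Set.mem_Iic, Finset.sum_apply]
  rw [← Finset.mul_sum, Finset.sum_sub_distrib, inv_mul_le_iff₀ hn', Real.sqrt_div (by positivity)]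
  simp only [Finset.sum_const, Finset.card_range, nsmul_eq_mul]
  have h12 : (0 : ℝ) < √12 := by positivity
  rw [← le_div_iff₀' h12, sub_le_iff_le_add]
  have : √(n : ℝ) * z / √12 + n * (1 / 2) = n / 2 + √n / √12 * z := by ring
  rw [this]

theorem monotone_irwinHall (n : ℕ) : Monotone (irwinHall n) := (irwinHall_isCDF_and_tendsto.1 n).1

theorem irwinHall_nonneg (n : ℕ) (x : ℝ) : 0 ≤ irwinHall n x :=
  ((irwinHall_isCDF_and_tendsto.1 n).2 x).1

theorem irwinHall_le_one (n : ℕ) (x : ℝ) : irwinHall n x ≤ 1 :=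
  ((irwinHall_isCDF_and_tendsto.1 n).2 x).2

theorem tendsto_irwinHall (z : ℝ) : Filter.Tendsto
    (fun n : ℕ => irwinHall n (n / 2 + √(n / 12) * z)) Filter.atTop (nhds (stdNormalCDF z)) :=
  irwinHall_isCDF_and_tendsto.2 z

theorem continuous_stdNormalCDF : Continuous stdNormalCDF := by
  have hint : Integrable (gaussianPDFReal 0 1) := integrable_gaussianPDFReal 0 1
  have h : stdNormalCDF = fun x => (∫ t in Set.Iic 0, gaussianPDFReal 0 1 t) +
      ∫ t in (0 : ℝ)..x, gaussianPDFReal 0 1 t := by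
    ext x
    rw [← intervalIntegral.integral_Iic_sub_Iic hint.integrableOn hint.integrableOn,
      add_sub_cancel]
    refine integral_congr_ae (Filter.Eventually.of_forall fun t => ?_)
    simp [gaussianPDFReal_def]
    ring
  rw [h]
  exact continuous_const.add (intervalIntegral.continuous_primitive
    (fun a b => hint.intervalIntegrable) 0)

theorem tendsto_stdNormalCDF_atBot :
    Filter.Tendsto stdNormalCDF Filter.atBot (nhds 0) := by
  have h : stdNormalCDF = cdf (gaussianReal 0 1) := by
    ext x
    rw [stdNormalCDF_eq, cdf_eq_real]
  rw [h]
  exact tendsto_cdf_atBot _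

theorem tendsto_stdNormalCDF_atTop :
    Filter.Tendsto stdNormalCDF Filter.atTop (nhds 1) := by
  have h : stdNormalCDF = cdf (gaussianReal 0 1) := by
    ext x
    rw [stdNormalCDF_eq, cdf_eq_real]
  rw [h]
  exact tendsto_cdf_atTop _

end IrwinHall

section Rows

/-- The sum of the first `m` coefficients of a polynomial. -/
noncomputable def partialSum (P : ℝ[X]) (m : ℕ) : ℝ := ∑ k ∈ range m, P.coeff k

@[simp]
theorem partialSum_zero (P : ℝ[X]) : partialSum P 0 = 0 := rfl

theorem partialSum_succ (P : ℝ[X]) (m : ℕ) :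
    partialSum P (m + 1) = partialSum P m + P.coeff m := sum_range_succ _ _

theorem partialSum_add (P Q : ℝ[X]) (m : ℕ) :
    partialSum (P + Q) m = partialSum P m + partialSum Q m := by
  simp [partialSum, sum_add_distrib]

theorem partialSum_neg (P : ℝ[X]) (m : ℕ) : partialSum (-P) m = -partialSum P m := by
  simp [partialSum]

theorem partialSum_X_mul (P : ℝ[X]) (m : ℕ) : partialSum (X * P) (m + 1) = partialSum P m := by
  simp [partialSum, sum_range_succ']

theorem abs_partialSum_X_mul_le {P : ℝ[X]} {C : ℝ} (h : ∀ m, |partialSum P m| ≤ C) (m : ℕ) :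
    |partialSum (X * P) m| ≤ C := by
  cases m with
  | zero => simpa using h 0
  | succ m => rw [partialSum_X_mul]; exact h m

theorem abs_partialSum_one_sub_X_mul_le {P : ℝ[X]} {C : ℝ} (h : ∀ m, |partialSum P m| ≤ C)
    (m : ℕ) : |partialSum ((1 - X) * P) m| ≤ 2 * C := by
  have e : (1 - X) * P = P + -(X * P) := by ring
  rw [e, partialSum_add, partialSum_neg]
  have := abs_add_le (partialSum P m) (-partialSum (X * P) m)
  rw [abs_neg] at this
  linarith [h m, abs_partialSum_X_mul_le h m]

theorem abs_partialSum_one_add_X_mul_le {P : ℝ[X]} {C : ℝ} (h : ∀ m, |partialSum P m| ≤ C)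
    (m : ℕ) : |partialSum ((1 + X) * P) m| ≤ 2 * C := by
  have e : (1 + X) * P = P + X * P := by ring
  rw [e, partialSum_add]
  linarith [abs_add_le (partialSum P m) (partialSum (X * P) m), h m,
    abs_partialSum_X_mul_le h m]

theorem abs_partialSum_one_sub_X_pow_le (n m : ℕ) :
    |partialSum ((1 - X) ^ n) m| ≤ 2 ^ n := by
  induction n generalizing m with
  | zero =>
    rw [pow_zero, pow_zero]
    cases m with
    | zero => simp
    | succ m => simp [partialSum, coeff_one]
  | succ n ih =>
    rw [pow_succ', pow_succ']
    exact abs_partialSum_one_sub_X_mul_le ih m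

theorem abs_partialSum_valleyPoly_unitHom_le (n m : ℕ) :
    |partialSum (valleyPoly unitHom n) m| ≤ 2 ^ n := by
  obtain ⟨k, rfl | rfl⟩ := Nat.even_or_odd' n
  · rw [(valleyPoly_unitHom k).1]
    exact abs_partialSum_one_sub_X_pow_le _ _
  · rw [(valleyPoly_unitHom k).2, mul_comm, pow_succ']
    exact abs_partialSum_one_add_X_mul_le (abs_partialSum_one_sub_X_pow_le _) m

theorem one_sub_X_pow_dvd_valleyPoly_unitHom (n : ℕ) :
    (1 - X : ℝ[X]) ^ (n - 1) ∣ valleyPoly unitHom n := by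
  obtain ⟨k, rfl | rfl⟩ := Nat.even_or_odd' n
  · rw [(valleyPoly_unitHom k).1]
    exact pow_dvd_pow _ (by omega)
  · rw [(valleyPoly_unitHom k).2]
    exact Dvd.intro _ rfl

theorem eval_one_of_one_sub_X_pow_dvd {R : ℝ[X]} (h : (1 - X) ^ 1 ∣ R) : R.eval 1 = 0 := by
  obtain ⟨Q, rfl⟩ := h
  simp

theorem one_sub_X_pow_dvd_derivative {R : ℝ[X]} {n : ℕ} (h : (1 - X) ^ (n + 1) ∣ R) :
    (1 - X) ^ n ∣ derivative R := by
  obtain ⟨Q, rfl⟩ := h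
  refine ⟨(1 - X) * derivative Q - ((n : ℝ[X]) + 1) * Q, ?_⟩
  rw [derivative_mul, derivative_pow_succ]
  simp
  ring

theorem tsum_coeff (P : ℝ[X]) : ∑' k, P.coeff k = P.eval 1 := by
  rw [eval_eq_sum_range, tsum_eq_sum (s := range (P.natDegree + 1))]
  · simp
  · intro k hk
    exact coeff_eq_zero_of_natDegree_lt (by simpa [Nat.lt_succ_iff] using hk)

theorem coeff_X_mul_derivative (P : ℝ[X]) (k : ℕ) :
    (X * derivative P).coeff k = k * P.coeff k := by
  cases k with
  | zero => simp
  | succ k => rw [coeff_X_mul, coeff_derivative]; push_cast; ring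

theorem tsum_mul_coeff (P : ℝ[X]) : ∑' k : ℕ, (k : ℝ) * P.coeff k = (derivative P).eval 1 := by
  simp only [← coeff_X_mul_derivative, tsum_coeff, eval_mul, eval_X, one_mul]

theorem tsum_sq_mul_coeff (P : ℝ[X]) : ∑' k : ℕ, (k : ℝ) ^ 2 * P.coeff k =
    (derivative P).eval 1 + (derivative (derivative P)).eval 1 := by
  have h : ∀ k : ℕ, (k : ℝ) ^ 2 * P.coeff k = k * (X * derivative P).coeff k := fun k => by
    rw [coeff_X_mul_derivative]; ring
  simp only [h, tsum_mul_coeff]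
  simp

variable {c : ℕ → ℕ → ℕ} {n : ℕ} {P : ℝ[X]}

theorem rowSum_eq (h : ∀ k, 4 * (c n k : ℝ) = P.coeff k) : rowSum c n = P.eval 1 / 4 := by
  rw [rowSum, ← tsum_coeff, ← tsum_div_const]
  exact tsum_congr fun k => by rw [← h]; ring

theorem rowMean_eq (h : ∀ k, 4 * (c n k : ℝ) = P.coeff k) :
    rowMean c n = (derivative P).eval 1 / P.eval 1 := by
  have : ∑' k : ℕ, (k : ℝ) * (c n k : ℝ) = (derivative P).eval 1 / 4 := by
    rw [← tsum_mul_coeff, ← tsum_div_const]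
    exact tsum_congr fun k => by rw [← h]; ring
  rw [rowMean, rowSum_eq h, this, div_div_div_cancel_right₀ four_ne_zero]

theorem rowVar_eq (h : ∀ k, 4 * (c n k : ℝ) = P.coeff k) :
    rowVar c n = ((derivative P).eval 1 + (derivative (derivative P)).eval 1) / P.eval 1 -
      ((derivative P).eval 1 / P.eval 1) ^ 2 := by
  have : ∑' k : ℕ, (k : ℝ) ^ 2 * (c n k : ℝ) =
      ((derivative P).eval 1 + (derivative (derivative P)).eval 1) / 4 := by
    rw [← tsum_sq_mul_coeff, ← tsum_div_const]
    exact tsum_congr fun k => by rw [← h]; ring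
  rw [rowVar, rowMean_eq h, rowSum_eq h, this, div_div_div_cancel_right₀ four_ne_zero]

theorem rowCDF_eq (h : ∀ k, 4 * (c n k : ℝ) = P.coeff k) (y : ℝ) :
    rowCDF c n y = partialSum P (if 0 ≤ y then ⌊y⌋₊ + 1 else 0) / P.eval 1 := by
  have : ∑' k : ℕ, (if (k : ℝ) ≤ y then (c n k : ℝ) else 0) =
      partialSum P (if 0 ≤ y then ⌊y⌋₊ + 1 else 0) / 4 := by
    split_ifs with hy
    · rw [tsum_eq_sum (s := range (⌊y⌋₊ + 1)), partialSum, sum_div]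
      · refine sum_congr rfl fun k hk => ?_
        rw [if_pos, ← h]
        · ring
        · rw [mem_range, Nat.lt_succ_iff] at hk
          exact (Nat.le_floor_iff hy).mp hk
      · intro k hk
        rw [if_neg]
        intro hk'
        exact hk (mem_range.mpr (Nat.lt_succ_iff.mpr ((Nat.le_floor_iff hy).mpr hk')))
    · have h0 : ∀ k : ℕ, (if (k : ℝ) ≤ y then (c n k : ℝ) else 0) = 0 := fun k =>
        if_neg fun hk => hy (le_trans (Nat.cast_nonneg k) hk)
      simp only [h0, tsum_zero, partialSum_zero, zero_div]
  rw [rowCDF, rowSum_eq h, this, div_div_div_cancel_right₀ four_ne_zero]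

theorem monotone_rowCDF (h : ∀ k, 4 * (c n k : ℝ) = P.coeff k) : Monotone (rowCDF c n) := by
  have hP : ∀ k, 0 ≤ P.coeff k := fun k => by rw [← h]; positivity
  intro x y hxy
  rw [rowCDF_eq h, rowCDF_eq h]
  have h1 : 0 ≤ P.eval 1 := by
    rw [← tsum_coeff]
    exact tsum_nonneg hP
  refine div_le_div_of_nonneg_right ?_ h1
  refine sum_le_sum_of_subset_of_nonneg (range_subset_range.mpr ?_) fun k _ _ => hP k
  split_ifs with hx hy
  · exact Nat.succ_le_succ (Nat.floor_mono hxy)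
  · exact absurd (hx.trans hxy) hy
  · exact Nat.zero_le _
  · exact le_rfl

theorem rowCDF_nonneg (c : ℕ → ℕ → ℕ) (n : ℕ) (y : ℝ) : 0 ≤ rowCDF c n y := by
  unfold rowCDF rowSum
  refine div_nonneg (tsum_nonneg fun k => ?_) (tsum_nonneg fun k => Nat.cast_nonneg _)
  split_ifs
  · exact Nat.cast_nonneg _
  · exact le_rfl

theorem rowCDF_le_one (h : ∀ k, 4 * (c n k : ℝ) = P.coeff k) (y : ℝ) : rowCDF c n y ≤ 1 := by
  have hs : Summable fun k => (c n k : ℝ) := by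
    refine summable_of_ne_finset_zero (s := range (P.natDegree + 1)) fun k hk => ?_
    have := h k
    rw [coeff_eq_zero_of_natDegree_lt (by simpa [Nat.lt_succ_iff] using hk)] at this
    linarith
  unfold rowCDF rowSum
  refine div_le_one_of_le₀ ?_ (tsum_nonneg fun k => Nat.cast_nonneg _)
  have hle : ∀ k : ℕ, (if (k : ℝ) ≤ y then (c n k : ℝ) else 0) ≤ c n k := fun k => by
    split_ifs
    · exact le_rfl
    · exact Nat.cast_nonneg _
  have h0 : ∀ k : ℕ, 0 ≤ (if (k : ℝ) ≤ y then (c n k : ℝ) else 0) := fun k => by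
    split_ifs
    · exact Nat.cast_nonneg _
    · exact le_rfl
  exact (Summable.of_nonneg_of_le h0 hle hs).tsum_le_tsum hle hs

theorem eval_one_valleyPoly_one (n : ℕ) :
    (valleyPoly (1 : ℤˣ →* ℝ[X]) n).eval 1 = 2 ^ n * n.factorial := by
  induction n with
  | zero => simp [valleyPoly_zero]
  | succ n ih =>
    rw [valleyPoly_one_succ]
    simp [ih, Nat.factorial_succ]
    ring

theorem eval_one_derivative_valleyPoly_one (n : ℕ) :
    (derivative (valleyPoly (1 : ℤˣ →* ℝ[X]) n)).eval 1 = n / 2 * (2 ^ n * n.factorial) := by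
  induction n with
  | zero => simp [valleyPoly_zero]
  | succ n ih =>
    rw [valleyPoly_one_succ]
    simp [ih, eval_one_valleyPoly_one, Nat.factorial_succ]
    ring

theorem eval_one_derivative_derivative_valleyPoly_one (n : ℕ) :
    (derivative (derivative (valleyPoly (1 : ℤˣ →* ℝ[X]) (n + 2)))).eval 1 =
      (3 * (n + 2) ^ 2 - 5 * (n + 2) + 1) / 12 * (2 ^ (n + 2) * (n + 2).factorial) := by
  have step : ∀ n, (derivative (derivative (valleyPoly (1 : ℤˣ →* ℝ[X]) (n + 1)))).eval 1 =
      (4 * n - 2) * (n / 2 * (2 ^ n * n.factorial)) +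
        (2 * n - 2) * (derivative (derivative (valleyPoly (1 : ℤˣ →* ℝ[X]) n))).eval 1 := by
    intro n
    rw [valleyPoly_one_succ]
    simp [← eval_one_derivative_valleyPoly_one]
    ring
  induction n with
  | zero => rw [step]; norm_num
  | succ n ih =>
    rw [step, ih, Nat.factorial_succ (n + 2)]
    push_cast
    ring

theorem partialSum_recurrence {P Q : ℝ[X]} {n : ℕ}
    (h : Q = (1 + (2 * (n : ℝ[X]) + 1) * X) * P + 2 * X * (1 - X) * derivative P) (m : ℕ) :
    partialSum Q (m + 1) =
      (2 * m + 1) * partialSum P (m + 1) + (2 * n + 1 - 2 * m) * partialSum P m := by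
  have e : Q = P + C (2 * (n : ℝ) + 1) * (X * P) +
      (C 2 * (X * derivative P) - C 2 * (X * (X * derivative P))) := by
    rw [h]
    simp only [map_add, map_mul, map_one, map_natCast, map_ofNat]
    ring
  induction m with
  | zero => rw [e]; simp [partialSum]
  | succ m ihm =>
    rw [partialSum_succ, ihm, partialSum_succ _ (m + 1), partialSum_succ _ m, e]
    simp only [coeff_add, coeff_sub, coeff_C_mul, coeff_X_mul, coeff_X_mul_derivative,
      coeff_derivative]
    push_cast
    ring

theorem partialSum_valleyPoly_one (n m : ℕ) :
    partialSum (valleyPoly (1 : ℤˣ →* ℝ[X]) n) m =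
      2 ^ n * n.factorial * irwinHall n (m - 1 / 2) := by
  induction n generalizing m with
  | zero =>
    rw [valleyPoly_zero]
    cases m with
    | zero => rw [irwinHall_of_neg _ (by norm_num)]; simp
    | succ m =>
      have : (0 : ℝ) ≤ m + 1 - 1 / 2 := by linarith [(Nat.cast_nonneg m : (0 : ℝ) ≤ m)]
      simp [partialSum, coeff_one, irwinHall, bdiff, truncPow]
      linarith
  | succ n ih =>
    cases m with
    | zero => rw [irwinHall_of_neg _ (by norm_num)]; simp
    | succ m =>
      rw [partialSum_recurrence (valleyPoly_one_succ n), ih, ih, Nat.factorial_succ]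
      have := irwinHall_succ n (m + 1 / 2)
      have h1 : ((m + 1 : ℕ) : ℝ) - 1 / 2 = m + 1 / 2 := by push_cast; ring
      have h2 : (m : ℝ) + 1 / 2 - 1 = m - 1 / 2 := by ring
      rw [h2] at this
      rw [h1]
      push_cast
      linear_combination (-(2 ^ (n + 1) * n.factorial : ℝ)) * this

end Rows

section Uniform

open Filter Topology

theorem tendstoUniformly_of_monotone {F : ℕ → ℝ → ℝ} {Φ : ℝ → ℝ} (hF : ∀ n, Monotone (F n))
    (h0 : ∀ n x, 0 ≤ F n x) (h1 : ∀ n x, F n x ≤ 1) (hΦ : Continuous Φ)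
    (hbot : Tendsto Φ atBot (𝓝 0)) (htop : Tendsto Φ atTop (𝓝 1))
    (h : ∀ x, Tendsto (fun n => F n x) atTop (𝓝 (Φ x))) :
    TendstoUniformly F Φ atTop := by
  have hmono : Monotone Φ := fun x y hxy => le_of_tendsto_of_tendsto' (h x) (h y) fun n => hF n hxy
  have hΦ0 : ∀ x, 0 ≤ Φ x := fun x => ge_of_tendsto' (h x) fun n => h0 n x
  have hΦ1 : ∀ x, Φ x ≤ 1 := fun x => le_of_tendsto' (h x) fun n => h1 n x
  have hlim : ∀ x, ∀ ε > 0, ∀ᶠ n in atTop, |F n x - Φ x| < ε := fun x ε hε => by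
    simpa [Real.dist_eq] using (tendsto_order.mp (tendsto_iff_dist_tendsto_zero.mp (h x))).2 ε hε
  rw [Metric.tendstoUniformly_iff]
  intro ε hε
  obtain ⟨A, hA⟩ := ((tendsto_order.mp hbot).2 (ε / 2) (by positivity)).exists
  obtain ⟨B, hB⟩ := ((tendsto_order.mp htop).1 (1 - ε / 2) (by linarith)).exists
  have hmid : ∀ᶠ n in atTop, ∀ x ∈ Set.Icc A B, |F n x - Φ x| < ε := by
    refine IsCompact.induction_on (p := fun s => ∀ᶠ n in atTop, ∀ x ∈ s, |F n x - Φ x| < ε)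
      isCompact_Icc (by simp) (fun s t hst ht => ?_) (fun s t hs ht => ?_) (fun x _ => ?_)
    · filter_upwards [ht] with n hn x hx using hn x (hst hx)
    · filter_upwards [hs, ht] with n hsn htn x hx using hx.elim (hsn x) (htn x)
    · obtain ⟨δ, hδ, hball⟩ := Metric.continuousAt_iff.mp hΦ.continuousAt (ε / 4) (by positivity)
      have ha := abs_lt.mp (hball (x := x - δ / 2) (by
        rw [Real.dist_eq, sub_sub_cancel_left, abs_neg, abs_of_pos (by positivity)]; linarith))
      have hb := abs_lt.mp (hball (x := x + δ / 2) (by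
        rw [Real.dist_eq, add_sub_cancel_left, abs_of_pos (by positivity)]; linarith))
      refine ⟨Set.Icc (x - δ / 2) (x + δ / 2),
        mem_nhdsWithin_of_mem_nhds (Icc_mem_nhds (by linarith) (by linarith)), ?_⟩
      filter_upwards [hlim (x - δ / 2) (ε / 4) (by positivity),
        hlim (x + δ / 2) (ε / 4) (by positivity)] with n hna hnb y hy
      rw [abs_lt] at hna hnb ⊢
      have := hF n hy.1
      have := hF n hy.2
      have := hmono hy.1
      have := hmono hy.2
      constructor <;> linarith [ha.1, hb.2, ha.2, hb.1]
  filter_upwards [hmid, hlim A (ε / 2) (by positivity), hlim B (ε / 2) (by positivity)]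
    with n hn hnA hnB x
  rw [dist_comm, Real.dist_eq]
  rcases lt_or_ge x A with hx | hx
  · rw [abs_lt] at hnA ⊢
    have := hF n hx.le
    have := hmono hx.le
    constructor <;> linarith [h0 n x, hΦ0 x]
  rcases lt_or_ge B x with hx' | hx'
  · rw [abs_lt] at hnB ⊢
    have := hF n hx'.le
    have := hmono hx'.le
    constructor <;> linarith [h1 n x, hΦ1 x]
  exact hn x ⟨hx, hx'⟩

theorem tendsto_iSup_abs_sub {F : ℕ → ℝ → ℝ} {Φ : ℝ → ℝ} (h : TendstoUniformly F Φ atTop) :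
    Tendsto (fun n => ⨆ x, |F n x - Φ x|) atTop (𝓝 0) := by
  rw [Metric.tendsto_atTop]
  intro ε hε
  obtain ⟨N, hN⟩ := eventually_atTop.mp (Metric.tendstoUniformly_iff.mp h (ε / 2) (by positivity))
  refine ⟨N, fun n hn => ?_⟩
  rw [Real.dist_eq, sub_zero, abs_of_nonneg (Real.iSup_nonneg fun x => abs_nonneg _)]
  refine lt_of_le_of_lt (Real.iSup_le (fun x => ?_) (by positivity)) (half_lt_self hε)
  have := hN n hn x
  rw [dist_comm, Real.dist_eq] at this
  exact this.le

theorem tendsto_irwinHall_of_tendsto {z : ℕ → ℝ} {x : ℝ} (hz : Tendsto z atTop (𝓝 x)) :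
    Tendsto (fun n : ℕ => irwinHall n (n / 2 + √(n / 12) * z n)) atTop (𝓝 (stdNormalCDF x)) := by
  refine (tendstoUniformly_of_monotone (F := fun n z => irwinHall n (n / 2 + √(n / 12) * z))
    (fun n a b hab => monotone_irwinHall n (by gcongr)) (fun _ _ => irwinHall_nonneg _ _)
    (fun _ _ => irwinHall_le_one _ _) continuous_stdNormalCDF tendsto_stdNormalCDF_atBot
    tendsto_stdNormalCDF_atTop tendsto_irwinHall).tendsto_comp
    continuous_stdNormalCDF.continuousAt hz

theorem tendsto_irwinHall_shift (x d : ℝ) :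
    Tendsto (fun n : ℕ => irwinHall n (x * √((n + 1) / 12) + n / 2 + d)) atTop
      (𝓝 (stdNormalCDF x)) := by
  have h1 : Tendsto (fun n : ℕ => √(((n : ℝ) + 1) / n)) atTop (𝓝 1) := by
    have h : Tendsto (fun n : ℕ => 1 + 1 / (n : ℝ)) atTop (𝓝 (1 + 0)) :=
      tendsto_const_nhds.add tendsto_one_div_atTop_nhds_zero_nat
    rw [add_zero] at h
    have := h.sqrt
    rw [Real.sqrt_one] at this
    refine this.congr' ?_
    filter_upwards [eventually_gt_atTop 0] with n hn
    have : (n : ℝ) ≠ 0 := by positivity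
    congr 1
    field_simp
  have h2 : Tendsto (fun n : ℕ => d / √((n : ℝ) / 12)) atTop (𝓝 0) :=
    tendsto_const_nhds.div_atTop (Real.tendsto_sqrt_atTop.comp
      (tendsto_natCast_atTop_atTop.atTop_div_const (by norm_num)))
  have h3 : Tendsto (fun n : ℕ => x * √(((n : ℝ) + 1) / n) + d / √((n : ℝ) / 12)) atTop (𝓝 x) := by
    simpa using (h1.const_mul x).add h2
  refine (tendsto_irwinHall_of_tendsto h3).congr' ?_
  filter_upwards [eventually_gt_atTop 0] with n hn
  have hn' : (0 : ℝ) < n := by exact_mod_cast hn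
  have hs : √((n : ℝ) / 12) ≠ 0 := by positivity
  have e : √(((n : ℝ) + 1) / 12) = √((n : ℝ) / 12) * √(((n : ℝ) + 1) / n) := by
    rw [← Real.sqrt_mul (by positivity)]
    congr 1
    field_simp
  congr 1
  rw [e]
  field_simp
  ring

end Uniform

section Main

open Filter Topology

variable {c : ℕ → ℕ → ℕ}

theorem rowMean_eq_of_dvd {n : ℕ} {R : ℝ[X]} (hn : 3 ≤ n)
    (h : ∀ k, 4 * (c n k : ℝ) = (valleyPoly (1 : ℤˣ →* ℝ[X]) n + R).coeff k)
    (hR : (1 - X) ^ (n - 1) ∣ R) : rowMean c n = n / 2 := by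
  have h0 : R.eval 1 = 0 :=
    eval_one_of_one_sub_X_pow_dvd ((pow_dvd_pow _ (by omega)).trans hR)
  have h1 : (derivative R).eval 1 = 0 := eval_one_of_one_sub_X_pow_dvd
    (one_sub_X_pow_dvd_derivative ((pow_dvd_pow _ (by omega)).trans hR))
  rw [rowMean_eq h, derivative_add, eval_add, eval_add, h0, h1, eval_one_valleyPoly_one,
    eval_one_derivative_valleyPoly_one]
  field_simp
  ring

theorem rowVar_eq_of_dvd {n : ℕ} {R : ℝ[X]} (hn : 4 ≤ n)
    (h : ∀ k, 4 * (c n k : ℝ) = (valleyPoly (1 : ℤˣ →* ℝ[X]) n + R).coeff k)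
    (hR : (1 - X) ^ (n - 1) ∣ R) : rowVar c n = (n + 1) / 12 := by
  have h0 : R.eval 1 = 0 :=
    eval_one_of_one_sub_X_pow_dvd ((pow_dvd_pow _ (by omega)).trans hR)
  have h1 : (derivative R).eval 1 = 0 := eval_one_of_one_sub_X_pow_dvd
    (one_sub_X_pow_dvd_derivative ((pow_dvd_pow _ (by omega)).trans hR))
  have h2 : (derivative (derivative R)).eval 1 = 0 := eval_one_of_one_sub_X_pow_dvd
    (one_sub_X_pow_dvd_derivative (one_sub_X_pow_dvd_derivative
      ((pow_dvd_pow _ (by omega)).trans hR)))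
  rw [rowVar_eq h]
  simp only [derivative_add, eval_add, h0, h1, h2, eval_one_valleyPoly_one,
    eval_one_derivative_valleyPoly_one]
  obtain ⟨m, rfl⟩ := Nat.exists_eq_add_of_le' (show 2 ≤ n by omega)
  rw [eval_one_derivative_derivative_valleyPoly_one]
  push_cast
  field_simp
  ring

theorem rowCDF_mem_Icc {n : ℕ} {R : ℝ[X]} (hn : 2 ≤ n)
    (h : ∀ k, 4 * (c n k : ℝ) = (valleyPoly (1 : ℤˣ →* ℝ[X]) n + R).coeff k)
    (hR : (1 - X) ^ (n - 1) ∣ R) (hb : ∀ m, |partialSum R m| ≤ 3 * 2 ^ n) (y : ℝ) :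
    rowCDF c n y ∈ Set.Icc (irwinHall n (y + -(1 / 2)) - 3 / n.factorial)
      (irwinHall n (y + 1 / 2) + 3 / n.factorial) := by
  have h0 : R.eval 1 = 0 :=
    eval_one_of_one_sub_X_pow_dvd ((pow_dvd_pow _ (by omega)).trans hR)
  have hf : (0 : ℝ) < n.factorial := by exact_mod_cast n.factorial_pos
  rw [rowCDF_eq h, eval_add, h0, add_zero, partialSum_add, eval_one_valleyPoly_one,
    partialSum_valleyPoly_one]
  set m := if 0 ≤ y then ⌊y⌋₊ + 1 else 0 with hm
  have hlow : irwinHall n (y + -(1 / 2)) ≤ irwinHall n (m - 1 / 2) := by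
    refine monotone_irwinHall n ?_
    rw [hm]
    split_ifs with hy
    · push_cast
      linarith [Nat.lt_floor_add_one y]
    · push_cast
      linarith
  have hhigh : irwinHall n (m - 1 / 2) ≤ irwinHall n (y + 1 / 2) := by
    rw [hm]
    split_ifs with hy
    · refine monotone_irwinHall n ?_
      push_cast
      linarith [Nat.floor_le hy]
    · rw [irwinHall_of_neg n (by norm_num)]
      exact irwinHall_nonneg _ _
  have e : (2 ^ n * n.factorial * irwinHall n (m - 1 / 2) + partialSum R m) /
      (2 ^ n * n.factorial) =
        irwinHall n (m - 1 / 2) + partialSum R m / 2 ^ n / n.factorial := by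
    field_simp
  have hle : |partialSum R m / 2 ^ n / n.factorial| ≤ 3 / n.factorial := by
    rw [abs_div, abs_div, abs_of_pos hf, abs_of_pos (by positivity : (0 : ℝ) < 2 ^ n)]
    gcongr
    rw [div_le_iff₀ (by positivity)]
    exact hb m
  rw [e]
  obtain ⟨h3, h4⟩ := abs_le.mp hle
  exact ⟨by linarith, by linarith⟩

theorem isAsympNormal_of_dvd (R : ℕ → ℝ[X])
    (h : ∀ n k, 4 * (c n k : ℝ) = (valleyPoly (1 : ℤˣ →* ℝ[X]) n + R n).coeff k)
    (hR : ∀ n, (1 - X) ^ (n - 1) ∣ R n) (hb : ∀ n m, |partialSum (R n) m| ≤ 3 * 2 ^ n) :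
    IsAsympNormal c := by
  refine tendsto_iSup_abs_sub (tendstoUniformly_of_monotone
    (F := fun n x => rowCDF c n (x * √(rowVar c n) + rowMean c n))
    (fun n a b hab => monotone_rowCDF (h n) (by gcongr)) (fun _ _ => rowCDF_nonneg _ _ _)
    (fun n _ => rowCDF_le_one (h n) _) continuous_stdNormalCDF tendsto_stdNormalCDF_atBot
    tendsto_stdNormalCDF_atTop fun x => ?_)
  have hd : Tendsto (fun n : ℕ => 3 / (n.factorial : ℝ)) atTop (𝓝 0) :=
    tendsto_const_nhds.div_atTop
      (tendsto_natCast_atTop_atTop.comp (tendsto_atTop_mono Nat.self_le_factorial tendsto_id))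
  have hl := (tendsto_irwinHall_shift x (-(1 / 2))).sub hd
  have hu := (tendsto_irwinHall_shift x (1 / 2)).add hd
  rw [sub_zero] at hl
  rw [add_zero] at hu
  refine tendsto_of_tendsto_of_tendsto_of_le_of_le' hl hu ?_ ?_ <;>
  · filter_upwards [eventually_ge_atTop 4] with n hn
    rw [rowMean_eq_of_dvd (by omega) (h n) (hR n), rowVar_eq_of_dvd hn (h n) (hR n)]
    have := rowCDF_mem_Icc (by omega) (h n) (hR n) (hb n) (x * √((n + 1) / 12) + n / 2)
    first | exact this.1 | exact this.2

/-- Theorem: the coefficients of `DExc_n^±(t)` are asymptotically normal; for `n ≥ 3` the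
mean is `n/2` and for `n ≥ 4` the variance is `(n+1)/12`. -/
theorem typeD_clt_exc_plus_minus :
    IsAsympNormal cDExcP ∧ IsAsympNormal cDExcM ∧
    (∀ n : ℕ, 3 ≤ n → rowMean cDExcP n = (n : ℝ) / 2 ∧ rowMean cDExcM n = (n : ℝ) / 2) ∧
    (∀ n : ℕ, 4 ≤ n →
      rowVar cDExcP n = ((n : ℝ) + 1) / 12 ∧ rowVar cDExcM n = ((n : ℝ) + 1) / 12) := by
  have hdP : ∀ n, (1 - X : ℝ[X]) ^ (n - 1) ∣ valleyPoly unitHom n + 2 * (1 - X) ^ n := fun n =>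
    dvd_add (one_sub_X_pow_dvd_valleyPoly_unitHom n)
      (Dvd.dvd.mul_left (pow_dvd_pow _ (Nat.sub_le n 1)) _)
  have hdM : ∀ n, (1 - X : ℝ[X]) ^ (n - 1) ∣ -valleyPoly unitHom n := fun n =>
    (one_sub_X_pow_dvd_valleyPoly_unitHom n).neg_right
  have hbP : ∀ n m, |partialSum (valleyPoly unitHom n + 2 * (1 - X) ^ n) m| ≤ 3 * 2 ^ n := by
    intro n m
    rw [two_mul, partialSum_add, partialSum_add]
    have h1 := abs_partialSum_valleyPoly_unitHom_le n m
    have h2 := abs_partialSum_one_sub_X_pow_le n m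
    rw [abs_le] at h1 h2 ⊢
    constructor <;> linarith
  have hbM : ∀ n m, |partialSum (-valleyPoly unitHom n) m| ≤ 3 * 2 ^ n := by
    intro n m
    rw [partialSum_neg, abs_neg]
    have : (0 : ℝ) < 2 ^ n := by positivity
    linarith [abs_partialSum_valleyPoly_unitHom_le n m]
  exact ⟨isAsympNormal_of_dvd (fun n => valleyPoly unitHom n + 2 * (1 - X) ^ n)
      four_mul_cDExcP hdP hbP,
    isAsympNormal_of_dvd (fun n => -valleyPoly unitHom n) four_mul_cDExcM hdM hbM,
    fun n hn => ⟨rowMean_eq_of_dvd hn (four_mul_cDExcP n) (hdP n),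
      rowMean_eq_of_dvd hn (four_mul_cDExcM n) (hdM n)⟩,
    fun n hn => ⟨rowVar_eq_of_dvd hn (four_mul_cDExcP n) (hdP n),
      rowVar_eq_of_dvd hn (four_mul_cDExcM n) (hdM n)⟩⟩

end Main
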